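/- Let (ξ_1, …, ξ_n) be a centered Gaussian vector and let Q be a partition of {1,…,n}. Then E[Π_{q ∈ Q} :Π_{i ∈ q} ξ_i:] = Σ_{Π ∈ M_c([n],Q)} Π_{{i,j} ∈ Π} E[ξ_i ξ_j], where M_c([n],Q) is the set of complete pairings Π of {1,…,n} such that no pair {i,j} ∈ Π has both i, j in the same block of Q. -/

import Mathlib

open MeasureTheory ProbabilityTheory Finset

noncomputable section

/-- The covariance `E[ξ_i ξ_j]` of two components of a random vector. -/
def cov {Ω : Type*} [MeasureSpace Ω] {n : ℕ} (ξ : Fin n → Ω → ℝ) (i j : Fin n) : ℝ :=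
  ∫ ω, ξ i ω * ξ j ω

/-- A partial pairing of the index set `s`, encoded as a finite set of ordered pairs `(i, j)`
with `i < j`, both entries in `s`, and the pairs pairwise disjoint. -/
def IsPartialPairingOn {n : ℕ} (s : Finset (Fin n)) (P : Finset (Fin n × Fin n)) : Prop :=
  (∀ p ∈ P, p.1 < p.2 ∧ p.1 ∈ s ∧ p.2 ∈ s) ∧
    ∀ p ∈ P, ∀ q ∈ P, p ≠ q → p.1 ≠ q.1 ∧ p.1 ≠ q.2 ∧ p.2 ≠ q.1 ∧ p.2 ≠ q.2

/-- The set `[Π]` of indices paired by a partial pairing. -/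
def paired {n : ℕ} (P : Finset (Fin n × Fin n)) : Finset (Fin n) :=
  P.biUnion fun p => {p.1, p.2}

/-- A complete pairing of `{0, …, n-1}`: a partial pairing covering every index. -/
def IsCompletePairing {n : ℕ} (P : Finset (Fin n × Fin n)) : Prop :=
  IsPartialPairingOn Finset.univ P ∧ paired P = Finset.univ

open scoped Classical in
/-- The Wick-ordered monomial `:Π_{i ∈ s} ξ_i:`, defined as
`Σ_Π Π_{i ∈ s ∖ [Π]} ξ_i · Π_{{i,j} ∈ Π} (−E[ξ_i ξ_j])` over partial pairings `Π` of `s`. -/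
def wickOn {Ω : Type*} [MeasureSpace Ω] {n : ℕ} (s : Finset (Fin n))
    (ξ : Fin n → Ω → ℝ) (ω : Ω) : ℝ :=
  ∑ P ∈ Finset.univ.filter (fun P : Finset (Fin n × Fin n) => IsPartialPairingOn s P),
    (∏ i ∈ s \ paired P, ξ i ω) * ∏ p ∈ P, (-(cov ξ p.1 p.2))

lemma mem_paired {n : ℕ} {P : Finset (Fin n × Fin n)} {i : Fin n} :
    i ∈ paired P ↔ ∃ p ∈ P, i = p.1 ∨ i = p.2 := by
  simp [paired]

lemma paired_union {n : ℕ} (P R : Finset (Fin n × Fin n)) :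
    paired (P ∪ R) = paired P ∪ paired R := Finset.union_biUnion

namespace IsPartialPairingOn

variable {n : ℕ} {s t : Finset (Fin n)} {P R : Finset (Fin n × Fin n)}

lemma paired_subset (hP : IsPartialPairingOn s P) : paired P ⊆ s := by
  intro i hi
  obtain ⟨p, hp, rfl | rfl⟩ := mem_paired.1 hi
  exacts [(hP.1 p hp).2.1, (hP.1 p hp).2.2]

lemma subset (hP : IsPartialPairingOn s P) (h : R ⊆ P) : IsPartialPairingOn s R :=
  ⟨fun p hp => hP.1 p (h hp), fun p hp q hq => hP.2 p (h hp) q (h hq)⟩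

lemma of_paired_subset (hP : IsPartialPairingOn s P) (h : paired P ⊆ t) :
    IsPartialPairingOn t P :=
  ⟨fun p hp => ⟨(hP.1 p hp).1, h (mem_paired.2 ⟨p, hp, .inl rfl⟩),
    h (mem_paired.2 ⟨p, hp, .inr rfl⟩)⟩, hP.2⟩

lemma mono (hP : IsPartialPairingOn s P) (h : s ⊆ t) : IsPartialPairingOn t P :=
  hP.of_paired_subset (hP.paired_subset.trans h)

lemma union (hP : IsPartialPairingOn s P) (hR : IsPartialPairingOn s R)
    (h : Disjoint (paired P) (paired R)) : IsPartialPairingOn s (P ∪ R) := by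
  have key : ∀ p ∈ P, ∀ q ∈ R, p.1 ≠ q.1 ∧ p.1 ≠ q.2 ∧ p.2 ≠ q.1 ∧ p.2 ≠ q.2 := by
    intro p hp q hq
    have h1 : p.1 ∈ paired P := mem_paired.2 ⟨p, hp, .inl rfl⟩
    have h2 : p.2 ∈ paired P := mem_paired.2 ⟨p, hp, .inr rfl⟩
    have h3 : q.1 ∈ paired R := mem_paired.2 ⟨q, hq, .inl rfl⟩
    have h4 : q.2 ∈ paired R := mem_paired.2 ⟨q, hq, .inr rfl⟩
    rw [Finset.disjoint_left] at h
    grind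
  refine ⟨fun p hp => ?_, fun p hp q hq hpq => ?_⟩
  · rcases Finset.mem_union.1 hp with hp | hp
    exacts [hP.1 p hp, hR.1 p hp]
  · rcases Finset.mem_union.1 hp with hp | hp <;> rcases Finset.mem_union.1 hq with hq | hq
    · exact hP.2 p hp q hq hpq
    · exact key p hp q hq
    · have := key q hq p hp
      grind
    · exact hR.2 p hp q hq hpq

lemma paired_sdiff (hP : IsPartialPairingOn s P) (h : R ⊆ P) :
    paired (P \ R) = paired P \ paired R := by
  ext i
  simp only [mem_paired, Finset.mem_sdiff]
  constructor
  · rintro ⟨p, ⟨hp, hpR⟩, hi⟩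
    refine ⟨⟨p, hp, hi⟩, ?_⟩
    rintro ⟨q, hq, hi'⟩
    have := hP.2 p hp q (h hq) (by rintro rfl; exact hpR hq)
    grind
  · rintro ⟨⟨p, hp, hi⟩, h'⟩
    exact ⟨p, ⟨hp, fun hpR => h' ⟨p, hpR, hi⟩⟩, hi⟩

end IsPartialPairingOn

lemma disjoint_of_disjoint_paired {n : ℕ} {P R : Finset (Fin n × Fin n)}
    (h : Disjoint (paired P) (paired R)) : Disjoint P R :=
  Finset.disjoint_left.2 fun p hp hp' => Finset.disjoint_left.1 h
    (mem_paired.2 ⟨p, hp, .inl rfl⟩) (mem_paired.2 ⟨p, hp', .inl rfl⟩)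

open scoped Classical in
/-- The sum over partial pairings `P` of `s` of `∏ i ∈ s \ [P], x i * ∏ p ∈ P, f p`. -/
def pairingSum {n : ℕ} (x : Fin n → ℝ) (f : Fin n × Fin n → ℝ) (s : Finset (Fin n)) : ℝ :=
  ∑ P ∈ Finset.univ.filter (fun P : Finset (Fin n × Fin n) => IsPartialPairingOn s P),
    (∏ i ∈ s \ paired P, x i) * ∏ p ∈ P, f p

lemma pairingSum_empty {n : ℕ} (x : Fin n → ℝ) (f : Fin n × Fin n → ℝ) :
    pairingSum x f ∅ = 1 := by
  classical
  have : Finset.univ.filter (fun P : Finset (Fin n × Fin n) => IsPartialPairingOn ∅ P) = {∅} := by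
    ext P
    simp only [Finset.mem_filter, Finset.mem_univ, true_and, Finset.mem_singleton]
    refine ⟨fun h => Finset.eq_empty_of_forall_notMem fun p hp => ?_, ?_⟩
    · simpa using (h.1 p hp).2.1
    · rintro rfl
      simp [IsPartialPairingOn]
  unfold pairingSum
  convert Finset.sum_singleton _ (∅ : Finset (Fin n × Fin n))
  simp

lemma pairingSum_union {n : ℕ} (x : Fin n → ℝ) (f : Fin n × Fin n → ℝ) {s t : Finset (Fin n)}
    (hst : Disjoint s t) (hf : ∀ p : Fin n × Fin n, p.1 ∈ s → p.2 ∈ t → f p = 0)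
    (hf' : ∀ p : Fin n × Fin n, p.1 ∈ t → p.2 ∈ s → f p = 0) :
    pairingSum x f (s ∪ t) = pairingSum x f s * pairingSum x f t := by
  classical
  unfold pairingSum
  rw [Finset.sum_mul_sum, ← Finset.sum_product']
  symm
  have hst' := Finset.disjoint_left.1 hst
  refine Finset.sum_of_injOn (fun R => R.1 ∪ R.2) ?_ ?_ ?_ ?_
  · rintro ⟨P, R⟩ h ⟨P', R'⟩ h' heq
    simp only [Finset.coe_product, Finset.coe_filter, Finset.mem_univ, true_and, Set.mem_prod,
      Set.mem_ofPred_eq] at h h' heq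
    have h1 : ∀ {P R}, IsPartialPairingOn s P → IsPartialPairingOn t R →
        (P ∪ R).filter (fun p => p.1 ∈ s) = P ∧ (P ∪ R).filter (fun p => p.1 ∈ t) = R := by
      intro P R hP hR
      have := hP.1
      have := hR.1
      constructor <;> ext p <;> grind
    have e := h1 h.1 h.2
    have e' := h1 h'.1 h'.2
    rw [heq] at e
    rw [Prod.mk.injEq]
    exact ⟨e.1.symm.trans e'.1, e.2.symm.trans e'.2⟩
  · rintro ⟨P, R⟩ h
    simp only [Finset.coe_product, Finset.coe_filter, Finset.mem_univ, true_and, Set.mem_prod,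
      Set.mem_ofPred_eq] at h ⊢
    exact (h.1.mono Finset.subset_union_left).union (h.2.mono Finset.subset_union_right)
      (hst.mono h.1.paired_subset h.2.paired_subset)
  · intro P hP hP'
    by_contra hne
    have hprod := right_ne_zero_of_mul hne
    rw [Finset.prod_ne_zero_iff] at hprod
    simp only [Finset.mem_filter, Finset.mem_univ, true_and] at hP
    apply hP'
    refine ⟨(P.filter (fun p => p.1 ∈ s), P.filter (fun p => p.1 ∈ t)), ?_, ?_⟩
    · simp only [Finset.coe_product, Finset.coe_filter, Finset.mem_univ, true_and, Set.mem_prod,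
        Set.mem_ofPred_eq]
      have hin := hP.1
      have := hP.2
      constructor <;> refine ⟨?_, (hP.subset (Finset.filter_subset _ _)).2⟩ <;> grind
    · have hin := hP.1
      ext p
      grind
  · rintro ⟨P, R⟩ h
    simp only [Finset.mem_product, Finset.mem_filter, Finset.mem_univ, true_and] at h
    have hP := h.1.paired_subset
    have hR := h.2.paired_subset
    have hd : (s ∪ t) \ paired (P ∪ R) = (s \ paired P) ∪ (t \ paired R) := by
      rw [paired_union]
      ext i
      have := @hP i
      have := @hR i
      have := @hst' i
      grind
    simp only
    rw [hd, Finset.prod_union (hst.mono Finset.sdiff_subset Finset.sdiff_subset),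
      Finset.prod_union (disjoint_of_disjoint_paired (hst.mono hP hR))]
    ring

lemma pairingSum_biUnion {n : ℕ} (x : Fin n → ℝ) (f : Fin n × Fin n → ℝ)
    (A : Finset (Finset (Fin n))) (hA : (A : Set (Finset (Fin n))).PairwiseDisjoint id)
    (hf : ∀ p : Fin n × Fin n, (∀ q ∈ A, ¬(p.1 ∈ q ∧ p.2 ∈ q)) → f p = 0) :
    pairingSum x f (A.biUnion id) = ∏ q ∈ A, pairingSum x f q := by
  classical
  suffices h : ∀ B ⊆ A, pairingSum x f (B.biUnion id) = ∏ q ∈ B, pairingSum x f q from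
    h A subset_rfl
  intro B
  induction B using Finset.induction_on with
  | empty => simp [pairingSum_empty]
  | insert q B hq ih =>
    intro hB
    have hqA : q ∈ A := hB (Finset.mem_insert_self _ _)
    have hBA : B ⊆ A := (Finset.subset_insert _ _).trans hB
    have huniq : ∀ r ∈ A, ∀ r' ∈ A, ∀ i, i ∈ r → i ∈ r' → r = r' := fun r hr r' hr' i hi hi' =>
      hA.elim_finset hr hr' i hi hi'
    have hdisj : ∀ i ∈ q, i ∉ B.biUnion id := by
      intro i hi hi'
      obtain ⟨r, hr, hir⟩ := Finset.mem_biUnion.1 hi'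
      exact hq (huniq q hqA r (hBA hr) i hi hir ▸ hr)
    rw [Finset.biUnion_insert, id, pairingSum_union, ih hBA, Finset.prod_insert hq]
    · exact Finset.disjoint_left.2 hdisj
    · refine fun p hp hp' => hf p fun r hr h => ?_
      rw [huniq r hr q hqA _ h.1 hp] at h
      exact hdisj _ h.2 hp'
    · refine fun p hp hp' => hf p fun r hr h => ?_
      rw [huniq r hr q hqA _ h.2 hp'] at h
      exact hdisj _ h.1 hp

open scoped Classical in
/-- The sum over the pairings `P` covering `s` of `∏ p ∈ P, f p`. -/
def completePairingSum {n : ℕ} (f : Fin n × Fin n → ℝ) (s : Finset (Fin n)) : ℝ :=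
  ∑ P ∈ Finset.univ.filter
      (fun P : Finset (Fin n × Fin n) => IsPartialPairingOn s P ∧ paired P = s),
    ∏ p ∈ P, f p

lemma eq_completePairingSum_of_recursion {n : ℕ} (f : Fin n × Fin n → ℝ)
    (M : Finset (Fin n) → ℝ) (h0 : M ∅ = 1)
    (hrec : ∀ a s, a ∉ s → M (insert a s) = ∑ b ∈ s, f (a, b) * M (s.erase b))
    (s : Finset (Fin n)) : M s = completePairingSum f s := by
  classical
  induction s using Finset.strongInduction with
  | H s ih =>
  rcases s.eq_empty_or_nonempty with rfl | hs
  · have : Finset.univ.filter (fun P : Finset (Fin n × Fin n) =>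
        IsPartialPairingOn ∅ P ∧ paired P = ∅) = {∅} := by
      ext P
      simp only [Finset.mem_filter, Finset.mem_univ, true_and, Finset.mem_singleton]
      refine ⟨fun h => Finset.eq_empty_of_forall_notMem fun p hp => ?_, ?_⟩
      · simpa using (h.1.1 p hp).2.1
      · rintro rfl
        simp [IsPartialPairingOn, paired]
    rw [h0]
    unfold completePairingSum
    convert (Finset.sum_singleton _ (∅ : Finset (Fin n × Fin n))).symm
    simp
  · set a := s.min' hs with ha_def
    have ha : a ∈ s := s.min'_mem hs
    have hmin : ∀ i ∈ s, a ≤ i := fun i hi => s.min'_le i hi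
    clear_value a
    rw [← Finset.insert_erase ha, hrec a _ (Finset.notMem_erase a s), Finset.insert_erase ha]
    have h1 : ∀ b ∈ s.erase a, f (a, b) * M ((s.erase a).erase b) =
        ∑ P ∈ Finset.univ.filter (fun P : Finset (Fin n × Fin n) =>
          IsPartialPairingOn ((s.erase a).erase b) P ∧ paired P = (s.erase a).erase b),
          f (a, b) * ∏ p ∈ P, f p := by
      intro b hb
      rw [ih _ ((Finset.erase_subset _ _).trans_ssubset (Finset.erase_ssubset ha)),
        completePairingSum, Finset.mul_sum]
    rw [Finset.sum_congr rfl h1, Finset.sum_sigma', completePairingSum]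
    have hnot : ∀ {b P}, paired P = (s.erase a).erase b → ∀ c, (a, c) ∉ P := by
      intro b P hP c hc
      have : a ∈ paired P := mem_paired.2 ⟨_, hc, .inl rfl⟩
      rw [hP] at this
      simp at this
    refine Finset.sum_bij (fun x _ => insert (a, x.1) x.2) ?_ ?_ ?_ ?_
    · rintro ⟨b, P⟩ h
      simp only [Finset.mem_sigma, Finset.mem_filter, Finset.mem_univ, true_and] at h ⊢
      obtain ⟨hb, hP, hPe⟩ := h
      have hsingle : paired {(a, b)} = {a, b} := by simp [paired]
      have hb' := Finset.mem_erase.1 hb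
      have hpair : IsPartialPairingOn s {(a, b)} := by
        have := lt_of_le_of_ne (hmin b hb'.2) hb'.1.symm
        constructor <;> grind
      rw [Finset.insert_eq]
      refine ⟨hpair.union (hP.mono ((Finset.erase_subset _ _).trans (Finset.erase_subset _ _))) ?_,
        ?_⟩
      · rw [hsingle, hPe, Finset.disjoint_left]
        grind
      · rw [paired_union, hsingle, hPe]
        ext i
        grind
    · rintro ⟨b, P⟩ h ⟨b', P'⟩ h' heq
      simp only [Finset.mem_sigma, Finset.mem_filter, Finset.mem_univ, true_and] at h h' heq
      have hb : b = b' := by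
        have : (a, b) ∈ insert (a, b') P' := heq ▸ Finset.mem_insert_self _ _
        rcases Finset.mem_insert.1 this with h1 | h1
        · exact (Prod.mk.inj h1).2
        · exact absurd h1 (hnot h'.2.2 b)
      subst hb
      have : P = P' := by
        rw [← Finset.erase_insert (hnot h.2.2 b), heq, Finset.erase_insert (hnot h'.2.2 b)]
      rw [this]
    · intro T hT
      simp only [Finset.mem_filter, Finset.mem_univ, true_and] at hT
      obtain ⟨hT, hTe⟩ := hT
      obtain ⟨⟨c, b⟩, hp, hap⟩ := mem_paired.1 (hTe ▸ ha)
      have hp' := hT.1 _ hp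
      have hc : c = a := by
        have := hmin _ hp'.2.1
        simp only at hap hp' this
        rcases hap with h | h
        · exact h.symm
        · exact absurd hp'.1 (by rw [← h]; exact not_lt.2 this)
      subst hc
      refine ⟨⟨b, T.erase (c, b)⟩, ?_, Finset.insert_erase hp⟩
      simp only [Finset.mem_sigma, Finset.mem_filter, Finset.mem_univ, true_and]
      have he : paired (T.erase (c, b)) = (s.erase c).erase b := by
        rw [Finset.erase_eq, hT.paired_sdiff (Finset.singleton_subset_iff.2 hp), hTe]
        ext i
        simp [paired]
        grind
      exact ⟨Finset.mem_erase.2 ⟨hp'.1.ne', hp'.2.2⟩,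
        (hT.subset (Finset.erase_subset _ _)).of_paired_subset he.subset, he⟩
    · rintro ⟨b, P⟩ h
      simp only [Finset.mem_sigma, Finset.mem_filter, Finset.mem_univ, true_and] at h
      rw [Finset.prod_insert (hnot h.2.2 b)]

open scoped Classical in
lemma sum_completePairingSum_sdiff {n : ℕ} (f g : Fin n × Fin n → ℝ) :
    ∑ P ∈ Finset.univ.filter
        (fun P : Finset (Fin n × Fin n) => IsPartialPairingOn Finset.univ P),
      completePairingSum g (Finset.univ \ paired P) * ∏ p ∈ P, f p =
    completePairingSum (fun p => f p + g p) Finset.univ := by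
  simp only [completePairingSum, Finset.prod_add, Finset.sum_mul]
  rw [Finset.sum_sigma', Finset.sum_sigma']
  refine Finset.sum_bij' (fun x _ => ⟨x.1 ∪ x.2, x.1⟩) (fun x _ => ⟨x.2, x.1 \ x.2⟩) ?_ ?_ ?_ ?_ ?_
  · rintro ⟨P, R⟩ h
    simp only [Finset.mem_sigma, Finset.mem_filter, Finset.mem_univ, true_and,
      Finset.mem_powerset] at h ⊢
    obtain ⟨hP, hR, hRe⟩ := h
    refine ⟨⟨hP.union (hR.mono (Finset.subset_univ _)) ?_, ?_⟩, Finset.subset_union_left⟩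
    · rw [hRe]
      exact Finset.disjoint_sdiff
    · rw [paired_union, hRe]
      simp
  · rintro ⟨T, P⟩ h
    simp only [Finset.mem_sigma, Finset.mem_filter, Finset.mem_univ, true_and,
      Finset.mem_powerset] at h ⊢
    obtain ⟨⟨hT, hTe⟩, hP⟩ := h
    have he : paired (T \ P) = Finset.univ \ paired P := by rw [hT.paired_sdiff hP, hTe]
    exact ⟨hT.subset hP, (hT.subset Finset.sdiff_subset).of_paired_subset he.subset, he⟩
  · rintro ⟨P, R⟩ h
    simp only [Finset.mem_sigma, Finset.mem_filter, Finset.mem_univ, true_and] at h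
    have hd : Disjoint P R := disjoint_of_disjoint_paired (by
      rw [h.2.2]; exact Finset.disjoint_sdiff)
    simp [Finset.union_sdiff_cancel_left hd]
  · rintro ⟨T, P⟩ h
    simp only [Finset.mem_sigma, Finset.mem_powerset] at h
    simp [Finset.union_sdiff_of_subset h.2]
  · rintro ⟨P, R⟩ h
    simp only [Finset.mem_sigma, Finset.mem_filter, Finset.mem_univ, true_and] at h
    have hd : Disjoint P R := disjoint_of_disjoint_paired (by
      rw [h.2.2]; exact Finset.disjoint_sdiff)
    simp only
    rw [Finset.union_sdiff_cancel_left hd, mul_comm]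

section GaussianMoments

variable {Ω : Type*} {n : ℕ} {ξ : Fin n → Ω → ℝ}

/-- The monomial `∏ i ∈ s, ξ i` weighted by the exponential `exp (∑ i, t i * ξ i)`. -/
def expMonomial (ξ : Fin n → Ω → ℝ) (s : Finset (Fin n)) (t : Fin n → ℝ) (ω : Ω) : ℝ :=
  (∏ i ∈ s, ξ i ω) * Real.exp (∑ i, t i * ξ i ω)

lemma sum_add_smul_single_mul (t : Fin n → ℝ) (a : Fin n) (x : ℝ) (y : Fin n → ℝ) :
    ∑ i, (t + x • Pi.single a (1 : ℝ) : Fin n → ℝ) i * y i = ∑ i, t i * y i + x * y a := by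
  simp [add_mul, Finset.sum_add_distrib, Pi.single_apply]

lemma expMonomial_add_smul_single (s : Finset (Fin n)) (t : Fin n → ℝ) (a : Fin n) (x : ℝ)
    (ω : Ω) : expMonomial ξ s (t + x • Pi.single a 1) ω =
      expMonomial ξ s t ω * Real.exp (x * ξ a ω) := by
  rw [expMonomial, expMonomial, sum_add_smul_single_mul, Real.exp_add, mul_assoc]

lemma abs_mul_exp_mul_le (y x : ℝ) (hx : |x| ≤ 1) :
    |y| * Real.exp (x * y) ≤ Real.exp (2 * y) + Real.exp (-2 * y) := by
  have h1 : |y| ≤ Real.exp |y| := (by linarith : |y| ≤ |y| + 1).trans (Real.add_one_le_exp _)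
  have h2 : x * y ≤ |y| := (le_abs_self _).trans (by
    rw [abs_mul]; exact mul_le_of_le_one_left (abs_nonneg y) hx)
  have h3 : |y| * Real.exp (x * y) ≤ Real.exp (2 * |y|) := by
    rw [two_mul, Real.exp_add]
    gcongr
  refine h3.trans ?_
  rcases abs_cases y with ⟨h, -⟩ | ⟨h, -⟩ <;> rw [h]
  · linarith [Real.exp_pos (-2 * y)]
  · rw [mul_neg, ← neg_mul]
    linarith [Real.exp_pos (2 * y)]

lemma abs_mul_expMonomial_le (s : Finset (Fin n)) (t : Fin n → ℝ) (a : Fin n) (x : ℝ)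
    (hx : |x| ≤ 1) (ω : Ω) :
    |ξ a ω * expMonomial ξ s (t + x • Pi.single a 1) ω| ≤
      |expMonomial ξ s (t + (2 : ℝ) • Pi.single a 1) ω| +
        |expMonomial ξ s (t + (-2 : ℝ) • Pi.single a 1) ω| := by
  simp only [expMonomial_add_smul_single, abs_mul, Real.abs_exp]
  have := mul_le_mul_of_nonneg_left (abs_mul_exp_mul_le (ξ a ω) x hx)
    (abs_nonneg (expMonomial ξ s t ω))
  linarith

lemma expMonomial_insert {s : Finset (Fin n)} {a : Fin n} (ha : a ∉ s) (t : Fin n → ℝ) (ω : Ω) :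
    expMonomial ξ (insert a s) t ω = ξ a ω * expMonomial ξ s t ω := by
  rw [expMonomial, expMonomial, Finset.prod_insert ha, mul_assoc]

variable [MeasureSpace Ω]

lemma measurable_expMonomial (hmeas : ∀ i, Measurable (ξ i)) (s : Finset (Fin n))
    (t : Fin n → ℝ) : Measurable (expMonomial ξ s t) := by
  unfold expMonomial
  fun_prop

lemma integrable_mul_expMonomial (hmeas : ∀ i, Measurable (ξ i)) {s : Finset (Fin n)}
    (hint : ∀ t, Integrable (expMonomial ξ s t)) (a : Fin n) (t : Fin n → ℝ) :
    Integrable (fun ω => ξ a ω * expMonomial ξ s t ω) := by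
  refine Integrable.mono' ((hint (t + (2 : ℝ) • Pi.single a 1)).abs.add
    (hint (t + (-2 : ℝ) • Pi.single a 1)).abs)
    ((hmeas a).mul (measurable_expMonomial hmeas s t)).aestronglyMeasurable
    (ae_of_all _ fun ω => ?_)
  simpa using abs_mul_expMonomial_le (ξ := ξ) s t a 0 (by simp) ω

lemma hasDerivAt_integral_expMonomial (hmeas : ∀ i, Measurable (ξ i)) {s : Finset (Fin n)}
    (hint : ∀ t, Integrable (expMonomial ξ s t)) (a : Fin n) (t : Fin n → ℝ) :
    HasDerivAt (fun x : ℝ => ∫ ω, expMonomial ξ s (t + x • Pi.single a 1) ω)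
      (∫ ω, ξ a ω * expMonomial ξ s t ω) 0 := by
  have hmeas' : ∀ t, AEStronglyMeasurable (expMonomial ξ s t) :=
    fun t => (measurable_expMonomial hmeas s t).aestronglyMeasurable
  have hd : ∀ (ω : Ω) (x : ℝ),
      HasDerivAt (fun x : ℝ => expMonomial ξ s (t + x • Pi.single a 1) ω)
        (ξ a ω * expMonomial ξ s (t + x • Pi.single a 1) ω) x := by
    intro ω x
    simp only [expMonomial_add_smul_single]
    refine ((((hasDerivAt_id x).mul_const (ξ a ω)).exp).const_mul
      (expMonomial ξ s t ω)).congr_deriv ?_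
    simp only [id]
    ring
  have hbound : ∀ (ω : Ω), ∀ x ∈ Metric.ball (0 : ℝ) 1,
      ‖ξ a ω * expMonomial ξ s (t + x • Pi.single a 1) ω‖ ≤
        |expMonomial ξ s (t + (2 : ℝ) • Pi.single a 1) ω| +
          |expMonomial ξ s (t + (-2 : ℝ) • Pi.single a 1) ω| := fun ω x hx =>
    abs_mul_expMonomial_le s t a x (mem_ball_zero_iff.1 hx).le ω
  have h := (hasDerivAt_integral_of_dominated_loc_of_deriv_le
    (Metric.ball_mem_nhds (0 : ℝ) one_pos)
    (Filter.Eventually.of_forall fun x : ℝ => hmeas' (t + x • Pi.single a 1))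
    (hint _) ((hmeas a).aestronglyMeasurable.mul (hmeas' _)) (ae_of_all _ hbound)
    ((hint _).abs.add (hint _).abs) (ae_of_all _ fun ω x _ => hd ω x)).2
  simpa using h

variable (hmeas : ∀ i, Measurable (ξ i))
  (hgauss : ∀ c : Fin n → ℝ, ∃ var : NNReal,
    Measure.map (fun ω => ∑ i, c i * ξ i ω) volume = gaussianReal 0 var)

include hmeas hgauss

lemma integrable_expMonomial (s : Finset (Fin n)) : ∀ t, Integrable (expMonomial ξ s t) := by
  induction s using Finset.induction_on with
  | empty =>
    intro t
    obtain ⟨v, hv⟩ := hgauss t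
    have h := integrable_exp_mul_gaussianReal (μ := 0) (v := v) 1
    rw [← hv, integrable_map_measure (by fun_prop) (by fun_prop)] at h
    refine h.congr (ae_of_all _ fun ω => ?_)
    simp [expMonomial]
  | insert a s ha ih =>
    intro t
    exact (integrable_mul_expMonomial hmeas ih a t).congr
      (ae_of_all _ fun ω => (expMonomial_insert ha t ω).symm)

lemma integrable_prod_of_gaussian (s : Finset (Fin n)) :
    Integrable (fun ω => ∏ i ∈ s, ξ i ω) :=
  (integrable_expMonomial hmeas hgauss s 0).congr (ae_of_all _ fun ω => by simp [expMonomial])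

lemma memLp_two_linear_combination (t : Fin n → ℝ) :
    MemLp (fun ω => ∑ i, t i * ξ i ω) 2 := by
  obtain ⟨v, hv⟩ := hgauss t
  have h := memLp_id_gaussianReal (μ := 0) (v := v) 2
  rw [← hv] at h
  exact h.comp_of_map (by fun_prop)

lemma memLp_two_component (i : Fin n) : MemLp (ξ i) 2 := by
  simpa [Pi.single_apply] using memLp_two_linear_combination hmeas hgauss (Pi.single i 1)

lemma integral_exp_linear_combination (t : Fin n → ℝ) :
    ∫ ω, expMonomial ξ ∅ t ω = Real.exp ((∫ ω, (∑ i, t i * ξ i ω) ^ 2) / 2) := by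
  obtain ⟨v, hv⟩ := hgauss t
  have hm := mgf_gaussianReal hv 1
  have hvar : ∫ ω, (∑ i, t i * ξ i ω) ^ 2 = v := by
    have h := variance_fun_id_gaussianReal (μ := 0) (v := v)
    rw [variance_eq_integral (by fun_prop), integral_id_gaussianReal, ← hv,
      integral_map (by fun_prop) (by fun_prop)] at h
    simpa using h
  rw [hvar]
  simpa [mgf, expMonomial] using hm

lemma integral_component_mul_linear_combination (a : Fin n) (t : Fin n → ℝ) :
    ∫ ω, ξ a ω * ∑ i, t i * ξ i ω = ∑ j, cov ξ a j * t j := by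
  simp only [Finset.mul_sum, cov]
  rw [integral_finsetSum]
  · refine Finset.sum_congr rfl fun j _ => ?_
    rw [← integral_mul_const]
    congr 1 with ω
    ring
  · intro j _
    exact (memLp_two_component hmeas hgauss a).integrable_mul
      ((memLp_two_component hmeas hgauss j).const_mul (t j))

lemma integral_mul_expMonomial_empty (a : Fin n) (t : Fin n → ℝ) :
    ∫ ω, ξ a ω * expMonomial ξ ∅ t ω =
      (∑ j, cov ξ a j * t j) * ∫ ω, expMonomial ξ ∅ t ω := by
  have h1 := hasDerivAt_integral_expMonomial hmeas (integrable_expMonomial hmeas hgauss ∅) a t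
  refine h1.unique ?_
  have hL := memLp_two_linear_combination hmeas hgauss t
  have hA := memLp_two_component hmeas hgauss a
  have hq : ∀ x : ℝ, ∫ ω, (∑ i, (t + x • Pi.single a (1 : ℝ) : Fin n → ℝ) i * ξ i ω) ^ 2 =
      (∫ ω, (∑ i, t i * ξ i ω) ^ 2) + (2 * x) * (∑ j, cov ξ a j * t j) + x ^ 2 * cov ξ a a := by
    intro x
    rw [← integral_component_mul_linear_combination hmeas hgauss, cov, ← integral_const_mul,
      ← integral_const_mul, ← integral_add, ← integral_add]
    · congr 1 with ω
      rw [sum_add_smul_single_mul t a x fun i => ξ i ω]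
      ring
    · exact hL.integrable_sq.add ((hA.integrable_mul hL).const_mul _)
    · exact (hA.integrable_mul hA).const_mul _
    · exact hL.integrable_sq
    · exact (hA.integrable_mul hL).const_mul _
  simp only [integral_exp_linear_combination hmeas hgauss, hq]
  have hd : HasDerivAt (fun x : ℝ => ((∫ ω, (∑ i, t i * ξ i ω) ^ 2) +
      (2 * x) * (∑ j, cov ξ a j * t j) + x ^ 2 * cov ξ a a) / 2) (∑ j, cov ξ a j * t j) 0 := by
    have := (((((hasDerivAt_id (0 : ℝ)).const_mul 2).mul_const (∑ j, cov ξ a j * t j)).const_add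
      (∫ ω, (∑ i, t i * ξ i ω) ^ 2)).add
      (((hasDerivAt_id (0 : ℝ)).pow 2).mul_const (cov ξ a a))).div_const 2
    refine this.congr_deriv ?_
    simp
  refine hd.exp.congr_deriv ?_
  simp [mul_comm]

/-- Gaussian integration by parts for monomials with an exponential weight. -/
lemma integral_mul_expMonomial {a : Fin n} {s : Finset (Fin n)} (ha : a ∉ s) : ∀ t : Fin n → ℝ,
    ∫ ω, ξ a ω * expMonomial ξ s t ω =
      (∑ j, cov ξ a j * t j) * (∫ ω, expMonomial ξ s t ω) +
        ∑ b ∈ s, cov ξ a b * ∫ ω, expMonomial ξ (s.erase b) t ω := by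
  induction s using Finset.induction_on with
  | empty => simpa using integral_mul_expMonomial_empty hmeas hgauss a
  | insert c s hc ih =>
    intro t
    have has : a ∉ s := fun h => ha (Finset.mem_insert_of_mem h)
    have hint := integrable_expMonomial hmeas hgauss
    have hderiv : ∀ r, HasDerivAt (fun x : ℝ => ∫ ω, expMonomial ξ r (t + x • Pi.single c 1) ω)
        (∫ ω, ξ c ω * expMonomial ξ r t ω) 0 := fun r =>
      hasDerivAt_integral_expMonomial hmeas (hint r) c t
    have hlhs : HasDerivAt
        (fun x : ℝ => ∫ ω, ξ a ω * expMonomial ξ s (t + x • Pi.single c 1) ω)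
        (∫ ω, ξ a ω * expMonomial ξ (insert c s) t ω) 0 := by
      have := hderiv (insert a s)
      simp only [expMonomial_insert has] at this
      simpa only [expMonomial_insert hc, mul_left_comm (ξ a _)] using this
    have hlin : HasDerivAt (fun x : ℝ => ∑ j, cov ξ a j * (t + x • Pi.single c (1 : ℝ) : Fin n → ℝ) j)
        (cov ξ a c) 0 := by
      have := ((hasDerivAt_id (0 : ℝ)).mul_const (cov ξ a c)).const_add (∑ j, t j * cov ξ a j)
      simp only [mul_comm (cov ξ a _), sum_add_smul_single_mul]
      simpa using this
    have hrhs := (hlin.mul (hderiv s)).add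
      (HasDerivAt.fun_sum fun b (_ : b ∈ s) => (hderiv (s.erase b)).const_mul (cov ξ a b))
    simp only [ih has] at hlhs
    rw [hlhs.unique hrhs, Finset.sum_insert hc, Finset.erase_insert hc]
    have hb : ∀ b ∈ s, cov ξ a b * ∫ ω, expMonomial ξ ((insert c s).erase b) t ω =
        cov ξ a b * ∫ ω, ξ c ω * expMonomial ξ (s.erase b) t ω := by
      intro b hb
      rw [Finset.erase_insert_of_ne (by rintro rfl; exact hc hb)]
      simp only [expMonomial_insert fun h => hc (Finset.mem_of_mem_erase h)]
    rw [Finset.sum_congr rfl hb]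
    simp only [expMonomial_insert hc, zero_smul, add_zero]
    ring

/-- Isserlis' theorem for square-free monomials. -/
lemma integral_prod_eq_completePairingSum [IsProbabilityMeasure (volume : Measure Ω)]
    (s : Finset (Fin n)) :
    ∫ ω, ∏ i ∈ s, ξ i ω = completePairingSum (fun p => cov ξ p.1 p.2) s := by
  refine eq_completePairingSum_of_recursion _ (fun s => ∫ ω, ∏ i ∈ s, ξ i ω) (by simp) ?_ s
  intro a s ha
  simpa [expMonomial, Finset.prod_insert ha] using integral_mul_expMonomial hmeas hgauss ha 0

end GaussianMoments

open scoped Classical in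
/-- Generalized Wick rule: for a centered Gaussian vector `(ξ_1, …, ξ_n)` and a partition `Q`
of `{1, …, n}`, `E[Π_{q ∈ Q} :Π_{i ∈ q} ξ_i:] = Σ_{Π ∈ M_c([n],Q)} Π_{{i,j} ∈ Π} E[ξ_i ξ_j]`,
where `M_c([n],Q)` is the set of complete pairings with no pair inside a single block of `Q`. -/
theorem wick_rule_partition {Ω : Type*} [MeasureSpace Ω]
    [IsProbabilityMeasure (volume : Measure Ω)]
    (n : ℕ) (Q : Finpartition (Finset.univ : Finset (Fin n)))
    (ξ : Fin n → Ω → ℝ)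
    (hmeas : ∀ i, Measurable (ξ i))
    (hcentered : ∀ i, ∫ ω, ξ i ω = 0)
    (hgauss : ∀ c : Fin n → ℝ, ∃ var : NNReal,
      Measure.map (fun ω => ∑ i, c i * ξ i ω) volume = gaussianReal 0 var) :
    ∫ ω, ∏ q ∈ Q.parts, wickOn q ξ ω =
      ∑ P ∈ Finset.univ.filter (fun P : Finset (Fin n × Fin n) =>
          IsCompletePairing P ∧ ∀ p ∈ P, ∀ q ∈ Q.parts, ¬(p.1 ∈ q ∧ p.2 ∈ q)),
        ∏ p ∈ P, cov ξ p.1 p.2 := by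
  let f : Fin n × Fin n → ℝ := fun p =>
    if ∃ q ∈ Q.parts, p.1 ∈ q ∧ p.2 ∈ q then -(cov ξ p.1 p.2) else 0
  have hwick : ∀ ω, ∏ q ∈ Q.parts, wickOn q ξ ω =
      pairingSum (fun i => ξ i ω) f Finset.univ := by
    intro ω
    have hQ : Q.parts.biUnion id = Finset.univ := Q.biUnion_parts
    have h := pairingSum_biUnion (fun i => ξ i ω) f Q.parts Q.disjoint ?_
    · rw [hQ] at h
      rw [h]
      refine Finset.prod_congr rfl fun q hq => Finset.sum_congr rfl fun P hP => ?_
      congr 1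
      refine Finset.prod_congr rfl fun p hp => (if_pos ⟨q, hq, ?_⟩).symm
      exact ((Finset.mem_filter.1 hP).2.1 p hp).2
    · intro p hp
      exact if_neg fun ⟨q, hq, h⟩ => hp q hq h
  simp only [hwick, pairingSum]
  rw [integral_finsetSum _ fun P _ =>
    (integrable_prod_of_gaussian hmeas hgauss _).mul_const _]
  simp only [integral_mul_const, integral_prod_eq_completePairingSum hmeas hgauss]
  rw [sum_completePairingSum_sdiff, completePairingSum]
  symm
  refine Finset.sum_subset_zero_on_sdiff ?_ ?_ ?_
  · intro P hP
    simp only [Finset.mem_filter, Finset.mem_univ, true_and] at hP ⊢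
    exact hP.1
  · intro P hP
    simp only [Finset.mem_sdiff, Finset.mem_filter, Finset.mem_univ, true_and, not_and] at hP
    have := hP.2 hP.1
    push Not at this
    obtain ⟨p, hp, q, hq, h⟩ := this
    refine Finset.prod_eq_zero hp ?_
    simp only [f]
    rw [if_pos ⟨q, hq, h⟩, neg_add_cancel]
  · intro P hP
    simp only [Finset.mem_filter, Finset.mem_univ, true_and] at hP
    refine Finset.prod_congr rfl fun p hp => ?_
    simp only [f]
    rw [if_neg fun ⟨q, hq, h⟩ => hP.2 p hp q hq h, zero_add]

end
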